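/- Let f : ℂ → ℝ be given by f(z) = (3/2)·log(1 + |z|²) − log|z³ − 1| on U = {z ∈ ℂ : z³ ≠ 1}. Then z = 0 is a strict local minimum of f, with f(0) = 0. -/

import Mathlib

open Complex

/-- The Kähler potential in the affine chart: f(z) = (3/2)·log(1+|z|²) − log|z³−1|. -/
noncomputable def kpot (z : ℂ) : ℝ :=
  (3 / 2) * Real.log (1 + ‖z‖ ^ 2) - Real.log (‖z ^ 3 - 1‖)

/-- `z = 0` is a strict local minimum of `kpot`, with value `0`. -/
theorem kpot_strict_local_min_at_zero :
    kpot 0 = 0 ∧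
      ∃ ε > (0 : ℝ), ∀ z : ℂ, ‖z‖ < ε → z ≠ 0 → kpot 0 < kpot z := by
  have h0 : kpot 0 = 0 := by simp [kpot]
  refine ⟨h0, 1, one_pos, fun z hz hz0 => ?_⟩
  rw [h0, kpot]
  have hr : 0 < ‖z‖ := norm_pos_iff.mpr hz0
  have hle : ‖z ^ 3 - 1‖ ≤ ‖z‖ ^ 3 + 1 := by
    have h := norm_sub_le (z ^ 3) 1
    rwa [norm_pow, norm_one] at h
  have hlt3 : ‖z‖ ^ 3 < ‖z‖ ^ 2 := pow_lt_pow_right_of_lt_one₀ hr hz (by norm_num)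
  have hsq : ‖z‖ ^ 2 < 1 := pow_lt_one₀ hr.le hz (by norm_num)
  have hge : 1 - ‖z‖ ^ 3 ≤ ‖z ^ 3 - 1‖ := by
    have h := norm_sub_norm_le (1 : ℂ) (z ^ 3)
    rwa [norm_pow, norm_one, norm_sub_rev] at h
  have hl : Real.log ‖z ^ 3 - 1‖ < Real.log (1 + ‖z‖ ^ 2) :=
    Real.log_lt_log (by linarith) (by linarith)
  have hp : 0 < Real.log (1 + ‖z‖ ^ 2) := Real.log_pos (by linarith [pow_pos hr 2])
  linarith
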